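/- arXiv:0801.3260 — 2 statements merged into one kernel-verified Lean document; each statement's English description precedes it below -/
import Mathlib

section
/- (Conjugation formula.) Let (V, Y, c) be a vertex coalgebra over F and let D* = (Id_V ⊗ c)Δ_{-2}. Then, as formal series in the commuting formal variables x and x_0, (Id_V ⊗ e^{−x_0 D*}) Y(x) e^{x_0 D*} = Y(x + x_0), where Y(x + x_0) denotes the expansion Σ_{k∈ℤ} Δ_k ⋅ (x + x_0)^{−k−1} with (x + x_0)^{−k−1} expanded in nonnegative integral powers of x_0. -/
/- Common background for the formalization of "Vertex coalgebras, comodules,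
cocommutativity and coassociativity" (K. Hubbard).

A vertex coalgebra `(V, Y, c)` is encoded by the family of coefficient maps
`Δ k : V →ₗ V ⊗ V` of the coproduct `Y(x)v = ∑ₖ Δ k v · x^(-k-1)` together with
the covacuum `c : V →ₗ F`.  All identities of formal series are encoded
coefficient-wise; in particular the Jacobi identity is encoded by its
(dual Borcherds) coefficient form. -/

noncomputable section

open scoped TensorProduct

variable (F : Type) [Field F] [CharZero F]

/-- The generalized binomial coefficient `(a choose i)` as an element of `F`. -/
def gchoose (a : ℤ) (i : ℕ) : F :=
  (∏ j ∈ Finset.range i, ((a : F) - (j : F))) / (Nat.factorial i : F)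

variable {V M : Type} [AddCommGroup V] [Module F V] [AddCommGroup M] [Module F M]

/-- `c ⊗ Id` composed with the canonical identification `F ⊗ M ≃ M`. -/
def cLeft (c : V →ₗ[F] F) : V ⊗[F] M →ₗ[F] M :=
  (TensorProduct.lid F M).toLinearMap ∘ₗ TensorProduct.map c LinearMap.id

/-- `Id ⊗ c` composed with the canonical identification `V ⊗ F ≃ V`. -/
def cRight (c : M →ₗ[F] F) : V ⊗[F] M →ₗ[F] V :=
  (TensorProduct.rid F V).toLinearMap ∘ₗ TensorProduct.map LinearMap.id c

/-- The transposition `T ⊗ Id` of the first two tensor factors of `V ⊗ (V ⊗ M)`. -/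
def Tfirst : V ⊗[F] (V ⊗[F] M) →ₗ[F] V ⊗[F] (V ⊗[F] M) :=
  (TensorProduct.assoc F V V M).toLinearMap ∘ₗ
    TensorProduct.map (TensorProduct.comm F V V).toLinearMap LinearMap.id ∘ₗ
    (TensorProduct.assoc F V V M).symm.toLinearMap

/-- The coefficient of `x₁^(-m-1) x₂^(-n-1)` in `(Id ⊗ Y(x₂)) Y(x₁)`. -/
def comp12 (ΔM : ℤ → M →ₗ[F] V ⊗[F] M) (m n : ℤ) : M →ₗ[F] V ⊗[F] (V ⊗[F] M) :=
  TensorProduct.map LinearMap.id (ΔM n) ∘ₗ ΔM m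

/-- The coefficient of `x₀^(-m-1) x₂^(-n-1)` in `(Y(x₀) ⊗ Id) Y(x₂)`. -/
def compR (ΔV : ℤ → V →ₗ[F] V ⊗[F] V) (ΔM : ℤ → M →ₗ[F] V ⊗[F] M) (m n : ℤ) :
    M →ₗ[F] V ⊗[F] (V ⊗[F] M) :=
  (TensorProduct.assoc F V V M).toLinearMap ∘ₗ TensorProduct.map (ΔV m) LinearMap.id ∘ₗ ΔM n

/-- The coefficient form of the (comodule) Jacobi identity of a vertex coalgebra,
obtained by extracting the coefficient of `x₀^(-a-1) x₁^(-b-1) x₂^(-c-1)`. -/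
def JacobiId (ΔV : ℤ → V →ₗ[F] V ⊗[F] V) (ΔM : ℤ → M →ₗ[F] V ⊗[F] M) : Prop :=
  ∀ (a b c : ℤ) (w : M),
    (∑ᶠ i : ℕ, ((-1 : F) ^ i * gchoose F a i) •
        (comp12 F ΔM (a + b - i) (c + i) w -
          (-1 : F) ^ a • Tfirst F (comp12 F ΔM (a + c - i) (b + i) w))) =
      ∑ᶠ i : ℕ, gchoose F b i • compR F ΔV ΔM (a + i) (b + c - i) w

/-- The axioms of a vertex coalgebra except the Jacobi identity: left counit,
cocreation and truncation, in coefficient form. -/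
def IsVertexCoalgSansJacobi (Δ : ℤ → V →ₗ[F] V ⊗[F] V) (c : V →ₗ[F] F) : Prop :=
  (∀ v : V, cLeft F c (Δ (-1) v) = v) ∧
  (∀ k : ℤ, k ≠ -1 → ∀ v : V, cLeft F c (Δ k v) = 0) ∧
  (∀ v : V, cRight F c (Δ (-1) v) = v) ∧
  (∀ k : ℤ, 0 ≤ k → ∀ v : V, cRight F c (Δ k v) = 0) ∧
  (∀ v : V, ∃ N : ℤ, ∀ k : ℤ, k < N → Δ k v = 0)

/-- The axioms of a vertex coalgebra. -/
def IsVertexCoalg (Δ : ℤ → V →ₗ[F] V ⊗[F] V) (c : V →ₗ[F] F) : Prop :=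
  IsVertexCoalgSansJacobi F Δ c ∧ JacobiId F Δ Δ

/-- The weight-`m` component of `V ⊗ V` for a graded space `V`. -/
def grT2 (gr : ℤ → Submodule F V) (m : ℤ) : Submodule F (V ⊗[F] V) :=
  ⨆ p : ℤ, LinearMap.range (TensorProduct.map (gr p).subtype (gr (m - p)).subtype)

/-- The weight-`m` component of `V ⊗ (V ⊗ V)` for a graded space `V`. -/
def grT3 (gr : ℤ → Submodule F V) (m : ℤ) : Submodule F (V ⊗[F] (V ⊗[F] V)) :=
  ⨆ p : ℤ × ℤ, LinearMap.range (TensorProduct.map (gr p.1).subtype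
    (TensorProduct.map (gr p.2).subtype (gr (m - p.1 - p.2)).subtype))

/-- The grading axioms of a graded vertex coalgebra: `V = ⊕ₖ V₍ₖ₎` internally,
`V₍ₖ₎ = 0` for `k` sufficiently small, and `Δ k` raises weight by `k + 1`. -/
def IsGradedVC (Δ : ℤ → V →ₗ[F] V ⊗[F] V) (gr : ℤ → Submodule F V) : Prop :=
  DirectSum.IsInternal gr ∧ (∃ N : ℤ, ∀ k : ℤ, k < N → gr k = ⊥) ∧
  (∀ r k : ℤ, ∀ v ∈ gr r, Δ k v ∈ grT2 F gr (r + k + 1))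

/-- `f` belongs to the graded dual `(V^{⊗3})'`: it vanishes on all but finitely
many homogeneous components of `V ⊗ V ⊗ V`. -/
def GradedDual3 (gr : ℤ → Submodule F V) (f : V ⊗[F] (V ⊗[F] V) →ₗ[F] F) : Prop :=
  ∃ s : Finset ℤ, ∀ m : ℤ, m ∉ s → ∀ u ∈ grT3 F gr m, f u = 0

/-- The weight-`q` component of `V ⊗ M` for `V` a `ℤ`-graded space and
`M` a `ℚ`-graded space. -/
def grVM (gr : ℤ → Submodule F V) (grM : ℚ → Submodule F M) (q : ℚ) :
    Submodule F (V ⊗[F] M) :=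
  ⨆ p : ℤ, LinearMap.range (TensorProduct.map (gr p).subtype (grM (q - p)).subtype)

/-- The weight-`q` component of `V ⊗ (V ⊗ M)`. -/
def grVVM (gr : ℤ → Submodule F V) (grM : ℚ → Submodule F M) (q : ℚ) :
    Submodule F (V ⊗[F] (V ⊗[F] M)) :=
  ⨆ p : ℤ × ℤ, LinearMap.range (TensorProduct.map (gr p.1).subtype
    (TensorProduct.map (gr p.2).subtype (grM (q - p.1 - p.2)).subtype))

/-- `f` belongs to the graded dual `(V ⊗ V ⊗ M)'`. -/
def GradedDualVVM (gr : ℤ → Submodule F V) (grM : ℚ → Submodule F M)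
    (f : V ⊗[F] (V ⊗[F] M) →ₗ[F] F) : Prop :=
  ∃ s : Finset ℚ, ∀ q : ℚ, q ∉ s → ∀ u ∈ grVVM F gr grM q, f u = 0

/-- The axioms of a comodule over a graded vertex coalgebra, except the Jacobi
identity: left counit, truncation, internal `ℚ`-grading bounded below, and the
grading condition on the comodule coproduct. -/
def IsComoduleSansJacobi (c : V →ₗ[F] F) (ΔM : ℤ → M →ₗ[F] V ⊗[F] M)
    (gr : ℤ → Submodule F V) (grM : ℚ → Submodule F M) : Prop :=
  (∀ w : M, cLeft F c (ΔM (-1) w) = w) ∧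
  (∀ k : ℤ, k ≠ -1 → ∀ w : M, cLeft F c (ΔM k w) = 0) ∧
  (∀ w : M, ∃ N : ℤ, ∀ k : ℤ, k < N → ΔM k w = 0) ∧
  DirectSum.IsInternal grM ∧ (∃ N : ℚ, ∀ q : ℚ, q < N → grM q = ⊥) ∧
  (∀ (j : ℚ) (k : ℤ), ∀ w ∈ grM j, ΔM k w ∈ grVM F gr grM (j + k + 1))

/-- Weak cocommutativity with exponent `k`, paired against `f`, coefficient-wise:
the coefficient of `x₁^(-b-1) x₂^(-c-1)` in
`(x₁-x₂)^k ⟨f, (Id ⊗ Y(x₂))Y(x₁)w - (T ⊗ Id)(Id ⊗ Y(x₁))Y(x₂)w⟩` vanishes. -/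
def WeakCocom (ΔM : ℤ → M →ₗ[F] V ⊗[F] M) (f : V ⊗[F] (V ⊗[F] M) →ₗ[F] F)
    (k : ℕ) : Prop :=
  ∀ (w : M) (b c : ℤ),
    ∑ j ∈ Finset.range (k + 1), ((-1 : F) ^ j * (k.choose j : F)) *
      (f (comp12 F ΔM (b + k - j) (c + j) w) -
        f (Tfirst F (comp12 F ΔM (c + j) (b + k - j) w))) = 0

/-- Weak coassociativity with exponent `k`, paired against `f`, coefficient-wise:
the coefficient of `x₀^(-a-1) x₂^(-c-1)` in
`(x₀+x₂)^k ⟨f, (Y(x₀) ⊗ Id)Y(x₂)w - (Id ⊗ Y(x₂))Y(x₀+x₂)w⟩` vanishes,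
`Y(x₀+x₂)` being expanded in nonnegative integral powers of `x₂`. -/
def WeakCoassoc (ΔV : ℤ → V →ₗ[F] V ⊗[F] V) (ΔM : ℤ → M →ₗ[F] V ⊗[F] M)
    (f : V ⊗[F] (V ⊗[F] M) →ₗ[F] F) (k : ℕ) : Prop :=
  ∀ (w : M) (a c : ℤ),
    ∑ j ∈ Finset.range (k + 1), (k.choose j : F) *
      (f (compR F ΔV ΔM (a + k - j) (c + j) w) -
        ∑ᶠ i : ℕ, ((-1 : F) ^ i * gchoose F (a + k - j) i) *
          f (comp12 F ΔM (a + k - j - i) (c + j + i) w)) = 0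

/-- The coefficient function of `x^r y^s (x + ε y)^t · A`, where `A : ℤ → ℤ → F`
is the coefficient function of a formal series (`A m n` is the coefficient of
`x^m y^n`). -/
def mulPoly (r s t : ℕ) (ε : F) (A : ℤ → ℤ → F) (m n : ℤ) : F :=
  ∑ j ∈ Finset.range (t + 1), (t.choose j : F) * ε ^ j *
    A (m - (r : ℤ) - ((t - j : ℕ) : ℤ)) (n - (s : ℤ) - (j : ℤ))

/-- `g` is the coefficient function of a polynomial in two variables. -/
def IsPolyCoeff (g : ℤ → ℤ → F) : Prop :=
  {p : ℤ × ℤ | g p.1 p.2 ≠ 0}.Finite ∧ ∀ m n : ℤ, m < 0 ∨ n < 0 → g m n = 0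

/-- The coefficient function of the polynomial `h(x₁ - x₂, x₂)` in the
variables `x₁, x₂`, given the coefficient function of `h = h(x₀, x₂)`. -/
def substC (h : ℤ → ℤ → F) (m n : ℤ) : F :=
  ∑ᶠ j : ℕ, ((-1 : F) ^ j * gchoose F (m + j) j) * h (m + j) (n - j)

/-- The coefficient form of the Jacobi identity of a vertex algebra (the
Borcherds identity). -/
def VAJacobi (mul : ℤ → V →ₗ[F] V →ₗ[F] V) : Prop :=
  ∀ (a b c : ℤ) (u v w : V),
    (∑ᶠ i : ℕ, ((-1 : F) ^ i * gchoose F a i) •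
        (mul (a + b - i) u (mul (c + i) v w) -
          (-1 : F) ^ a • mul (a + c - i) v (mul (b + i) u w))) =
      ∑ᶠ i : ℕ, gchoose F b i • mul (b + c - i) (mul (a + i) u v) w

/-- The axioms of a vertex algebra: truncation, vacuum, creation and the Jacobi
identity, in coefficient form (`mul n u v` is `u_n v`). -/
def IsVA (mul : ℤ → V →ₗ[F] V →ₗ[F] V) (one : V) : Prop :=
  (∀ u v : V, ∃ N : ℤ, ∀ n : ℤ, N < n → mul n u v = 0) ∧
  (∀ v : V, mul (-1) one v = v) ∧
  (∀ n : ℤ, n ≠ -1 → ∀ v : V, mul n one v = 0) ∧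
  (∀ v : V, mul (-1) v one = v) ∧
  (∀ n : ℤ, 0 ≤ n → ∀ v : V, mul n v one = 0) ∧
  VAJacobi F mul

/-- The graded dual `V' = ⊕ₖ V₍ₖ₎*`, realized as the submodule of the full dual
consisting of functionals vanishing on all but finitely many components. -/
def gradedDual (gr : ℤ → Submodule F V) : Submodule F (Module.Dual F V) where
  carrier := {φ | ∃ s : Finset ℤ, ∀ k ∉ s, ∀ u ∈ gr k, φ u = 0}
  zero_mem' := ⟨∅, by intro k _ u _; simp⟩
  add_mem' := by
    rintro a b ⟨s, hs⟩ ⟨t, ht⟩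
    refine ⟨s ∪ t, ?_⟩
    intro k hk u hu
    simp only [Finset.mem_union, not_or] at hk
    simp [LinearMap.add_apply, hs k hk.1 u hu, ht k hk.2 u hu]
  smul_mem' := by
    rintro r a ⟨s, hs⟩
    refine ⟨s, ?_⟩
    intro k hk u hu
    simp [LinearMap.smul_apply, hs k hk u hu]

/-- The weight-`k` component `V₍ₖ₎* ⊆ V'` of the graded dual: functionals
vanishing on every component of weight other than `k`. -/
def gradedDualPiece (gr : ℤ → Submodule F V) (k : ℤ) :
    Submodule F ↥(gradedDual F gr) where
  carrier := {φ | ∀ j : ℤ, j ≠ k → ∀ u ∈ gr j, (φ : Module.Dual F V) u = 0}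
  zero_mem' := by intro j _ u _; simp
  add_mem' := by
    intro a b ha hb j hj u hu
    simp [ha j hj u hu, hb j hj u hu]
  smul_mem' := by
    intro r a ha j hj u hu
    simp [ha j hj u hu]

/-- The natural pairing of `V' ⊗ V'` with `V ⊗ V`. -/
def pairVV (gr : ℤ → Submodule F V) :
    ↥(gradedDual F gr) ⊗[F] ↥(gradedDual F gr) →ₗ[F] Module.Dual F (V ⊗[F] V) :=
  TensorProduct.dualDistrib F V V ∘ₗ
    TensorProduct.map (gradedDual F gr).subtype (gradedDual F gr).subtype

/-- The covacuum map on the graded dual: evaluation at the vacuum. -/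
def covac (gr : ℤ → Submodule F V) (one : V) : ↥(gradedDual F gr) →ₗ[F] F :=
  LinearMap.applyₗ one ∘ₗ (gradedDual F gr).subtype

/-- A bilinear form `B` on `V` extended componentwise to `V ⊗ V`. -/
def formT2 (B : V →ₗ[F] V →ₗ[F] F) : V ⊗[F] V →ₗ[F] Module.Dual F (V ⊗[F] V) :=
  TensorProduct.dualDistrib F V V ∘ₗ TensorProduct.map B B

section

variable {K : Type} [Field K] {U N : Type} [AddCommGroup U] [Module K U]
  [AddCommGroup N] [Module K N]

theorem map_cRight_Tfirst (c : N →ₗ[K] K) (g : N →ₗ[K] U ⊗[K] N) (t : U ⊗[K] N) :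
    TensorProduct.map LinearMap.id (cRight K c)
        (Tfirst K (TensorProduct.map LinearMap.id g t)) =
      TensorProduct.comm K U U (TensorProduct.map LinearMap.id (cRight K c ∘ₗ g) t) := by
  have key (u : U) (s : U ⊗[K] N) :
      TensorProduct.map LinearMap.id (cRight K c) (Tfirst K (u ⊗ₜ[K] s)) =
        cRight K c s ⊗ₜ[K] u := by
    induction s with
    | zero => simp
    | add x y hx hy => simp [TensorProduct.tmul_add, TensorProduct.add_tmul, hx, hy]
    | tmul x y => simp [Tfirst, cRight, TensorProduct.smul_tmul]
  induction t with
  | zero => simp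
  | add x y hx hy => simp only [map_add, hx, hy]
  | tmul x y => simp [key]

theorem map_cRight_assoc (c : N →ₗ[K] K) (f : U →ₗ[K] U ⊗[K] U) (t : U ⊗[K] N) :
    TensorProduct.map LinearMap.id (cRight K c)
        (TensorProduct.assoc K U U N (TensorProduct.map f LinearMap.id t)) =
      f (cRight K c t) := by
  have key (s : U ⊗[K] U) (y : N) :
      TensorProduct.map LinearMap.id (cRight K c)
        (TensorProduct.assoc K U U N (s ⊗ₜ[K] y)) = c y • s := by
    induction s with
    | zero => simp
    | add x y hx hy => simp [TensorProduct.add_tmul, hx, hy]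
    | tmul x y => simp [cRight]
  induction t with
  | zero => simp
  | add x y hx hy => simp only [map_add, hx, hy]
  | tmul x y =>
    rw [TensorProduct.map_tmul, LinearMap.id_apply, key]
    simp [cRight]

theorem map_cRight_comp12 (c : N →ₗ[K] K) (Δ : ℤ → N →ₗ[K] U ⊗[K] N) (m n : ℤ) (w : N) :
    TensorProduct.map LinearMap.id (cRight K c) (comp12 K Δ m n w) =
      TensorProduct.map LinearMap.id (cRight K c ∘ₗ Δ n) (Δ m w) := by
  simp only [comp12, LinearMap.comp_apply]
  rw [← LinearMap.comp_apply, ← TensorProduct.map_comp, LinearMap.id_comp]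

theorem pow_apply_of_apply_eq_neg_smul_sub_one {E : Type*} [AddCommGroup E] [Module K E]
    (A : ℤ → E) (R : Module.End K E)
    (hR : ∀ k, R (A k) = -((k : K) • A (k - 1))) (k : ℤ) (p : ℕ) :
    (R ^ p) (A k) = ((-1 : K) ^ p * ∏ j ∈ Finset.range p, ((k : K) - (j : K))) • A (k - p) := by
  induction p with
  | zero => simp
  | succ p ih =>
    rw [pow_succ', Module.End.mul_apply, ih, map_smul, hR, Finset.prod_range_succ, ← neg_smul,
      smul_smul, pow_succ]
    congr 1
    · push_cast; ring
    · congr 1; push_cast; ring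

end

/-- The commutator formula `Y(x) D* - (Id ⊗ D*) Y(x) = (d/dx) Y(x)` in coefficients. -/
theorem IsVertexCoalg.coproduct_comp_Dstar {Δ : ℤ → V →ₗ[F] V ⊗[F] V} {c : V →ₗ[F] F}
    (hVC : IsVertexCoalg F Δ c) (k : ℤ) (w : V) :
    Δ k (cRight F c (Δ (-2) w)) =
      TensorProduct.map LinearMap.id (cRight F c ∘ₗ Δ (-2)) (Δ k w) -
        (k : F) • Δ (k - 1) w := by
  obtain ⟨⟨-, -, hone, hpos, htrunc⟩, hJ⟩ := hVC
  have d_one : cRight F c ∘ₗ Δ (-1) = LinearMap.id := LinearMap.ext hone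
  have d_pos (n : ℤ) (hn : 0 ≤ n) : cRight F c ∘ₗ Δ n = 0 := LinearMap.ext (hpos n hn)
  obtain ⟨N, hN⟩ := htrunc w
  have comp_zero (m n : ℤ) (hm : m < N) : comp12 F Δ m n w = 0 := by simp [comp12, hN m hm]
  have jac := congrArg (TensorProduct.map LinearMap.id (cRight F c)) (hJ k 0 (-2) w).symm
  rw [finsum_eq_single _ 0, finsum_eq_sum_of_support_subset
    (s := Finset.range ((k - N).toNat + 2))] at jac
  · rw [map_sum, ← Finset.sum_subset (Finset.range_mono (Nat.le_add_left 2 _))] at jac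
    · simp only [Finset.sum_range_succ, Finset.sum_range_zero, map_smul, map_sub,
        map_cRight_comp12, compR, LinearMap.comp_apply, LinearEquiv.coe_coe, map_cRight_assoc] at jac
      simp only [comp12, LinearMap.comp_apply, map_cRight_Tfirst] at jac
      simp [gchoose, d_one, d_pos] at jac
      exact jac.trans (sub_eq_add_neg _ _).symm
    · intro i _ hi
      have hi : 2 ≤ i := by simpa [Nat.succ_le_iff] using hi
      rw [map_smul, map_sub, map_smul, map_cRight_comp12, d_pos _ (by omega)]
      conv_lhs => rw [comp12, LinearMap.comp_apply, map_cRight_Tfirst, d_pos _ (by omega)]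
      simp
  · intro i hi
    by_contra hlt
    have hlt : (k - N).toNat + 2 ≤ i := by simpa using hlt
    refine hi ?_
    dsimp only
    rw [comp_zero _ _ (by omega), comp_zero _ _ (by omega)]
    simp
  · intro i hi
    have : gchoose F 0 i = 0 := by
      rw [gchoose, Finset.prod_eq_zero (Finset.mem_range.2 (Nat.pos_of_ne_zero hi)) (by simp),
        zero_div]
    rw [this, zero_smul]

/-- Conjugation formula: For a vertex coalgebra `(V, Y, c)` with
`D* = (Id ⊗ c)Δ₋₂`, `(Id ⊗ e^{-x₀D*}) Y(x) e^{x₀D*} = Y(x + x₀)`, with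
`(x+x₀)^(-k-1)` expanded in nonnegative integral powers of `x₀`.  Extracting
the coefficient of `x^(-k-1) x₀^p`:
`∑_{i+j=p} ((-1)^j/(i! j!)) (Id ⊗ (D*)^j)(Δ k ((D*)^i v)) = (-1)^p (k choose p) Δ (k-p) v`. -/
theorem Dstar_conjugation
    (Δ : ℤ → V →ₗ[F] V ⊗[F] V) (c : V →ₗ[F] F)
    (hVC : IsVertexCoalg F Δ c)
    (Dstar : V →ₗ[F] V) (hD : Dstar = cRight F c ∘ₗ Δ (-2)) :
    ∀ (k : ℤ) (p : ℕ) (v : V),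
      ∑ j ∈ Finset.range (p + 1),
          ((-1 : F) ^ j * (Nat.factorial j : F)⁻¹ * (Nat.factorial (p - j) : F)⁻¹) •
            TensorProduct.map LinearMap.id (Dstar ^ j) (Δ k ((Dstar ^ (p - j)) v))
        = ((-1 : F) ^ p * gchoose F k p) • Δ (k - p) v := by
  intro k p v
  let R : Module.End F (V →ₗ[F] V ⊗[F] V) := LinearMap.lcomp F _ Dstar
  let S : Module.End F (V →ₗ[F] V ⊗[F] V) :=
    LinearMap.llcomp F V _ _ (TensorProduct.map LinearMap.id Dstar)
  have hcomm : Commute (-S) R := LinearMap.ext fun A => (map_neg R (S A)).symm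
  have hRpow (n : ℕ) (A : V →ₗ[F] V ⊗[F] V) (v : V) : (R ^ n) A v = A ((Dstar ^ n) v) := by
    induction n generalizing A v with
    | zero => rfl
    | succ n ih =>
      rw [pow_succ, Module.End.mul_apply, ih, pow_succ', Module.End.mul_apply]
      rfl
  have hSpow (n : ℕ) (A : V →ₗ[F] V ⊗[F] V) (v : V) :
      (S ^ n) A v = TensorProduct.map LinearMap.id (Dstar ^ n) (A v) := by
    induction n generalizing A v with
    | zero =>
      rw [pow_zero, pow_zero, Module.End.one_eq_id, Module.End.one_eq_id,
        TensorProduct.map_id]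
      rfl
    | succ n ih =>
      rw [pow_succ', Module.End.mul_apply, pow_succ', Module.End.mul_eq_comp,
        ← LinearMap.id_comp (LinearMap.id : V →ₗ[F] V), TensorProduct.map_comp,
        LinearMap.comp_apply, ← ih]
      rfl
  have hbase (k : ℤ) : (-S + R) (Δ k) = -((k : F) • Δ (k - 1)) := by
    ext w
    have := hVC.coproduct_comp_Dstar F k w
    subst hD
    simp [R, S, this, neg_add_eq_sub]
  have hpow := LinearMap.congr_fun
    (pow_apply_of_apply_eq_neg_smul_sub_one Δ (-S + R) hbase k p) v
  rw [hcomm.add_pow, LinearMap.sum_apply, LinearMap.sum_apply, LinearMap.smul_apply] at hpow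
  have hp : (p.factorial : F) ≠ 0 := Nat.cast_ne_zero.2 p.factorial_ne_zero
  refine (smul_right_injective _ hp) ?_
  dsimp only
  rw [smul_smul, gchoose, mul_left_comm, mul_div_cancel₀ _ hp, ← hpow, Finset.smul_sum]
  refine Finset.sum_congr rfl fun j hj => ?_
  have hj : j ≤ p := Finset.mem_range_succ_iff.1 hj
  rw [← neg_one_smul F S, smul_pow, smul_mul_assoc, smul_mul_assoc, LinearMap.smul_apply,
    LinearMap.smul_apply, ← nsmul_eq_mul', LinearMap.smul_apply, LinearMap.smul_apply,
    Module.End.mul_apply, hSpow, hRpow, smul_smul, ← Nat.cast_smul_eq_nsmul F, smul_smul,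
    Nat.cast_choose F hj]
  congr 1
  field_simp
end
end

section
/- (Weak coassociativity.) Let (V, Y, c) be a graded vertex coalgebra over F. For every v' ∈ (V^{⊗3})' there exists k ∈ ℤ_+ (depending only on v') such that for every v ∈ V, (x_0+x_2)^k ⟨v', (Y(x_0) ⊗ Id_V)Y(x_2)v − (Id_V ⊗ Y(x_2))Y(x_0 + x_2)v⟩ = 0 as a formal series in x_0, x_2, where Y(x_0 + x_2) is expanded in nonnegative integral powers of x_2. -/
/- Common background for the formalization of "Vertex coalgebras, comodules,
cocommutativity and coassociativity" (K. Hubbard).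

A vertex coalgebra `(V, Y, c)` is encoded by the family of coefficient maps
`Δ k : V →ₗ V ⊗ V` of the coproduct `Y(x)v = ∑ₖ Δ k v · x^(-k-1)` together with
the covacuum `c : V →ₗ F`.  All identities of formal series are encoded
coefficient-wise; in particular the Jacobi identity is encoded by its
(dual Borcherds) coefficient form. -/

noncomputable section

open scoped TensorProduct

variable (F : Type) [Field F] [CharZero F]

variable {V M : Type} [AddCommGroup V] [Module F V] [AddCommGroup M] [Module F M]

theorem gchoose_zero_right (a : ℤ) : gchoose F a 0 = 1 := by
  simp [gchoose]

theorem gchoose_zero_succ (i : ℕ) : gchoose F 0 (i + 1) = 0 := by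
  simp [gchoose, Finset.prod_range_succ']

/-- Pascal's rule for generalized binomial coefficients. -/
theorem gchoose_succ_succ (a : ℤ) (i : ℕ) :
    gchoose F (a + 1) (i + 1) = gchoose F a i + gchoose F a (i + 1) := by
  have h₁ : ((i : F) + 1) ≠ 0 := by exact_mod_cast i.succ_ne_zero
  have h₂ : (Nat.factorial i : F) ≠ 0 := by exact_mod_cast i.factorial_ne_zero
  have h₃ : ∏ j ∈ Finset.range i, (((a + 1 : ℤ) : F) - ((j + 1 : ℕ) : F)) =
      ∏ j ∈ Finset.range i, ((a : F) - (j : F)) :=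
    Finset.prod_congr rfl fun j _ => by push_cast; ring
  unfold gchoose
  rw [Finset.prod_range_succ', h₃, Finset.prod_range_succ, Nat.factorial_succ]
  push_cast
  field_simp
  ring

theorem gchoose_natCast (n i : ℕ) : gchoose F (n : ℤ) i = (n.choose i : F) := by
  induction n generalizing i with
  | zero =>
    cases i with
    | zero => simp [gchoose_zero_right]
    | succ i => simpa using gchoose_zero_succ F i
  | succ n ih =>
    cases i with
    | zero => simp [gchoose_zero_right]
    | succ i =>
      rw [Nat.cast_succ, gchoose_succ_succ, ih, ih, Nat.choose_succ_succ, Nat.cast_add]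

/-- The coefficient of `x₀^(-p-1) x₂^(-q-1)` in `(x₀ + x₂)^k A(x₀ + x₂, x₂)`, where `g m n` is the
coefficient of `x₁^(-m-1) x₂^(-n-1)` in `A(x₁, x₂)`. -/
def shiftCoeff (g : ℤ → ℤ → F) (k : ℕ) (p q : ℤ) : F :=
  ∑ᶠ i : ℕ, ((-1 : F) ^ i * gchoose F p i) * g (p + k - i) (q + i)

theorem finsum_eq_sum_range {A : Type*} [AddCommMonoid A] {h : ℕ → A} {L : ℕ}
    (hL : ∀ i, L ≤ i → h i = 0) : ∑ᶠ i, h i = ∑ i ∈ Finset.range L, h i := by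
  refine finsum_eq_sum_of_support_subset _ fun i hi => ?_
  by_contra hiL
  exact hi (hL i (by simpa using hiL))

theorem shiftCoeff_succ {g : ℤ → ℤ → F} {N : ℤ} (hg : ∀ m n, m < N → g m n = 0)
    (k : ℕ) (p q : ℤ) :
    shiftCoeff F g (k + 1) p q = shiftCoeff F g k (p + 1) q + shiftCoeff F g k p (q + 1) := by
  obtain ⟨L, hL⟩ : ∃ L : ℕ, p + k - L < N := ⟨(p + k - N + 1).toNat, by omega⟩
  unfold shiftCoeff
  rw [finsum_eq_sum_range (L := L + 1), finsum_eq_sum_range (L := L + 1),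
    finsum_eq_sum_range (L := L), Finset.sum_range_succ', Finset.sum_range_succ',
    add_right_comm, ← Finset.sum_add_distrib]
  · congr 1
    · refine Finset.sum_congr rfl fun i _ => ?_
      rw [gchoose_succ_succ,
        show p + ((k + 1 : ℕ) : ℤ) - ((i + 1 : ℕ) : ℤ) = p + k - i by push_cast; ring,
        show p + 1 + (k : ℤ) - ((i + 1 : ℕ) : ℤ) = p + k - i by push_cast; ring,
        show q + 1 + (i : ℤ) = q + ((i + 1 : ℕ) : ℤ) by push_cast; ring]
      ring
    · simp only [gchoose_zero_right]
      congr 2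
      push_cast
      ring
  all_goals
    intro i hi
    rw [hg _ _ (by omega), mul_zero]

theorem sum_choose_mul_shiftCoeff {g : ℤ → ℤ → F} {N : ℤ} (hg : ∀ m n, m < N → g m n = 0)
    (k : ℕ) (p q : ℤ) :
    ∑ j ∈ Finset.range (k + 1), (k.choose j : F) * shiftCoeff F g 0 (p + k - j) (q + j) =
      shiftCoeff F g k p q := by
  induction k generalizing p q with
  | zero => simp
  | succ k ih =>
    rw [shiftCoeff_succ F hg, ← ih, ← ih, Finset.sum_choose_succ_mul
      (fun j _ => shiftCoeff F g 0 (p + (k + 1 : ℕ) - j) (q + j))]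
    congr 1 <;> refine Finset.sum_congr rfl fun j _ => ?_ <;> congr 2 <;> push_cast <;> ring

variable {F}

/-- A functional in the graded dual of `V ⊗ V ⊗ V` kills the image of `(T ⊗ Id)(Id ⊗ Δ n)` for
all sufficiently large `n`. -/
theorem exists_Tfirst_map_eq_zero {Δ : ℤ → V →ₗ[F] V ⊗[F] V} {gr : ℤ → Submodule F V}
    (hgr : IsGradedVC F Δ gr) {f : V ⊗[F] (V ⊗[F] V) →ₗ[F] F} (hf : GradedDual3 F gr f) :
    ∃ K : ℤ, ∀ n, K ≤ n → ∀ t : V ⊗[F] V,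
      f (Tfirst F (TensorProduct.map LinearMap.id (Δ n) t)) = 0 := by
  obtain ⟨hint, ⟨N, hN⟩, hΔ⟩ := hgr
  obtain ⟨s, hs⟩ := hf
  obtain ⟨B, hB⟩ := s.bddAbove
  refine ⟨B - 2 * N, fun n hn t => ?_⟩
  have htop := hint.submodule_iSup_eq_top
  have key : ∀ p r : ℤ, ∀ u ∈ gr p, ∀ v ∈ gr r, f (Tfirst F (u ⊗ₜ Δ n v)) = 0 := by
    intro p r u hu v hv
    rcases lt_or_ge p N with hp | hp
    · rw [hN p hp, Submodule.mem_bot] at hu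
      simp [hu]
    rcases lt_or_ge r N with hr | hr
    · rw [hN r hr, Submodule.mem_bot] at hv
      simp [hv]
    have hm : p + (r + n + 1) ∉ s := fun h => by
      have := hB h
      omega
    suffices h : grT2 F gr (r + n + 1) ≤
        (f ∘ₗ Tfirst F ∘ₗ TensorProduct.mk F V (V ⊗[F] V) u).ker from
      LinearMap.mem_ker.mp (h (hΔ r n v hv))
    refine iSup_le fun p' => ?_
    rintro _ ⟨z, rfl⟩
    induction z with
    | zero => simp
    | add x y hx hy => rw [map_add]; exact add_mem hx hy
    | tmul x y =>
      refine LinearMap.mem_ker.mpr (hs _ hm _ ?_)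
      refine Submodule.mem_iSup_of_mem (p', p) ?_
      refine ⟨x ⊗ₜ (⟨u, hu⟩ ⊗ₜ ⟨y, ?_⟩), by simp [Tfirst]⟩
      have := y.2
      rwa [show p + (r + n + 1) - p' - p = r + n + 1 - p' by ring]
  induction t with
  | zero => simp
  | add x y hx hy => simp [hx, hy]
  | tmul u v =>
    rw [TensorProduct.map_tmul, LinearMap.id_apply]
    have hu : u ∈ ⨆ p, gr p := htop ▸ Submodule.mem_top
    have hv : v ∈ ⨆ p, gr p := htop ▸ Submodule.mem_top
    induction hu using Submodule.iSup_induction' with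
    | zero => simp
    | add x y _ _ hx hy => simp [TensorProduct.add_tmul, hx, hy]
    | mem p u hu =>
      induction hv using Submodule.iSup_induction' with
      | zero => simp
      | add x y _ _ hx hy => simp [TensorProduct.tmul_add, hx, hy]
      | mem r v hv => exact key p r u hu v hv

/-- The Jacobi identity multiplied by `x₁^k` and reduced to its `x₁`-residue, paired against a
functional which kills the transposed term. -/
theorem JacobiId.sum_choose_mul_compR {Δ : ℤ → V →ₗ[F] V ⊗[F] V} (hJ : JacobiId F Δ Δ)
    {f : V ⊗[F] (V ⊗[F] V) →ₗ[F] F} {k : ℕ}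
    (hf : ∀ n, (k : ℤ) ≤ n → ∀ t : V ⊗[F] V,
      f (Tfirst F (TensorProduct.map LinearMap.id (Δ n) t)) = 0)
    {w : V} {N : ℤ} (hN : ∀ m, m < N → Δ m w = 0) (a c : ℤ) :
    ∑ j ∈ Finset.range (k + 1), (k.choose j : F) * f (compR F Δ Δ (a + k - j) (c + j) w) =
      shiftCoeff F (fun m n => f (comp12 F Δ m n w)) k a c := by
  have hcomp : ∀ m n, m < N → comp12 F Δ m n w = 0 := fun m n hm => by simp [comp12, hN m hm]
  obtain ⟨L, hL₁, hL₂⟩ : ∃ L : ℕ, a + k - L < N ∧ a + c - L < N :=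
    ⟨(a + k - N + 1).toNat + (a + c - N + 1).toNat, by omega, by omega⟩
  have h := congrArg f (hJ a k c w)
  rw [finsum_eq_sum_range (L := L), finsum_eq_sum_range (L := k + 1), map_sum, map_sum] at h
  · rw [shiftCoeff, finsum_eq_sum_range (L := L)]
    · have hT : ∀ i : ℕ, f (Tfirst F (comp12 F Δ (a + c - i) (k + i) w)) = 0 := fun i =>
        hf _ (by omega) _
      simp only [map_smul, map_sub, hT, smul_eq_mul, mul_zero, sub_zero] at h
      rw [h, ← Finset.sum_range_reflect]
      refine Finset.sum_congr rfl fun j hj => ?_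
      have hjk : j ≤ k := Nat.lt_succ_iff.mp (Finset.mem_range.mp hj)
      rw [Nat.add_sub_cancel, Nat.choose_symm hjk, gchoose_natCast, Nat.cast_sub hjk]
      congr 4 <;> ring
    · intro i hi
      rw [hcomp _ _ (by omega), map_zero, mul_zero]
  · intro i hi
    rw [gchoose_natCast, Nat.choose_eq_zero_of_lt (by omega), Nat.cast_zero, zero_smul]
  · intro i hi
    rw [hcomp _ _ (by omega), hcomp _ _ (by omega), map_zero, smul_zero, sub_zero, smul_zero]

variable (F)

/-- Weak coassociativity: For a graded vertex coalgebra `(V, Y, c)`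
and every `v'` in the graded dual `(V^{⊗3})'` there exists `k ∈ ℤ₊`, depending
only on `v'`, such that for every `v ∈ V`,
`(x₀+x₂)^k ⟨v', (Y(x₀) ⊗ Id)Y(x₂)v - (Id ⊗ Y(x₂))Y(x₀+x₂)v⟩ = 0`, where
`Y(x₀+x₂)` is expanded in nonnegative integral powers of `x₂`. -/
theorem weak_coassociativity
    (Δ : ℤ → V →ₗ[F] V ⊗[F] V) (c : V →ₗ[F] F) (gr : ℤ → Submodule F V)
    (hVC : IsVertexCoalg F Δ c) (hgr : IsGradedVC F Δ gr)
    (f : V ⊗[F] (V ⊗[F] V) →ₗ[F] F) (hf : GradedDual3 F gr f) :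
    ∃ k : ℕ, 0 < k ∧ WeakCoassoc F Δ Δ f k := by
  obtain ⟨⟨-, -, -, -, htrunc⟩, hJ⟩ := hVC
  obtain ⟨K, hK⟩ := exists_Tfirst_map_eq_zero hgr hf
  refine ⟨K.toNat + 1, Nat.succ_pos _, fun w a c => ?_⟩
  obtain ⟨N, hN⟩ := htrunc w
  have hg : ∀ m n, m < N → f (comp12 F Δ m n w) = 0 := fun m n hm => by simp [comp12, hN m hm]
  have h₁ := hJ.sum_choose_mul_compR (k := K.toNat + 1) (fun n hn => hK n (by omega)) hN a c
  have h₂ := sum_choose_mul_shiftCoeff F hg (K.toNat + 1) a c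
  simp only [mul_sub, Finset.sum_sub_distrib]
  rw [h₁, ← h₂, sub_eq_zero]
  simp only [shiftCoeff, Nat.cast_zero, add_zero]
end
end
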